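/- For all n, n' ∈ ℕ₀ and indices 1 ≤ l ≤ 2n+1, 1 ≤ l' ≤ 2n'+1, the spherical harmonics satisfy the orthonormality relation ∫₀^π ∫₀^{2π} Y_l^n(θ,φ) Y_{l'}^{n'}(θ,φ) sinθ dφ dθ = δ_{nn'} δ_{ll'}, where δ denotes the Kronecker delta. -/

import Mathlib

open MeasureTheory Real
open scoped RealInnerProductSpace

noncomputable section

/-- Jacobi polynomial `P_n^{α,β}(t)`. -/
def jacobiP (n : ℕ) (α β : ℝ) (t : ℝ) : ℝ :=
  (Real.Gamma (α + n + 1) / (n.factorial * Real.Gamma (α + β + n + 1))) *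
    ∑ m ∈ Finset.range (n + 1), (n.choose m : ℝ) *
      (Real.Gamma (α + β + n + m + 1) / Real.Gamma (α + m + 1)) * ((t - 1) / 2) ^ m

/-- Normalization constant `C_{n,j}` of spherical harmonics. -/
def sphC (n j : ℕ) : ℝ :=
  (1 / 2 ^ j) * Real.sqrt ((2 * n + 1) * Real.Gamma ((n : ℝ) - j + 1) *
    Real.Gamma ((n : ℝ) + j + 1) / (2 * Real.pi * Real.Gamma ((n : ℝ) + 1) ^ 2))

/-- Spherical harmonic `Y_l^n(θ, φ)`; for `l = 2j` the cosine type, for `l = 2j+1 ≥ 3`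
the sine type (in both cases `j = l / 2` by natural division). -/
def sphY (n l : ℕ) (θ φ : ℝ) : ℝ :=
  if l = 1 then Real.sqrt ((2 * n + 1) / (4 * Real.pi)) * jacobiP n 0 0 (Real.cos θ)
  else if l % 2 = 0 then
    sphC n (l / 2) * Real.sin θ ^ (l / 2) * Real.cos ((l / 2 : ℕ) * φ) *
      jacobiP (n - l / 2) (l / 2 : ℕ) (l / 2 : ℕ) (Real.cos θ)
  else
    sphC n (l / 2) * Real.sin θ ^ (l / 2) * Real.sin ((l / 2 : ℕ) * φ) *
      jacobiP (n - l / 2) (l / 2 : ℕ) (l / 2 : ℕ) (Real.cos θ)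

end

open Nat in
/-- The Beta integral at positive integers. -/
theorem integral_pow_mul_one_sub_pow (p q : ℕ) :
    ∫ x in (0 : ℝ)..1, x ^ p * (1 - x) ^ q = (p ! * q ! : ℝ) / (p + q + 1)! := by
  have h := Complex.Gamma_mul_Gamma_eq_betaIntegral (s := (p : ℂ) + 1) (t := (q : ℂ) + 1)
    (by simp; positivity) (by simp; positivity)
  have e : (p : ℂ) + 1 + ((q : ℂ) + 1) = ((p + q + 1 : ℕ) : ℂ) + 1 := by push_cast; ring
  rw [e, Complex.Gamma_nat_eq_factorial, Complex.Gamma_nat_eq_factorial,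
    Complex.Gamma_nat_eq_factorial, Complex.betaIntegral] at h
  simp only [add_sub_cancel_right, Complex.cpow_natCast] at h
  have h' : ∫ x in (0 : ℝ)..1, (x : ℂ) ^ p * (1 - (x : ℂ)) ^ q =
      ((∫ x in (0 : ℝ)..1, x ^ p * (1 - x) ^ q : ℝ) : ℂ) := by
    rw [← intervalIntegral.integral_ofReal]
    simp
  rw [h'] at h
  rw [eq_div_iff (by positivity), mul_comm]
  exact_mod_cast h.symm

open Polynomial Nat in
/-- Alternating binomial sums annihilate polynomials of low degree. -/
theorem sum_alternating_choose_mul_eval_eq_zero {N : ℕ} {P : ℝ[X]} (hP : P.natDegree < N) :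
    ∑ m ∈ Finset.range (N + 1), (-1 : ℝ) ^ m * N.choose m * P.eval (m : ℝ) = 0 := by
  have h := congrFun (Polynomial.fwdDiff_iter_eq_zero_of_degree_lt hP) 0
  rw [fwdDiff_iter_eq_sum_shift] at h
  have h2 : ∑ m ∈ Finset.range (N + 1), (-1 : ℝ) ^ m * N.choose m * P.eval (m : ℝ) =
      (-1) ^ N * ∑ k ∈ Finset.range (N + 1),
        ((-1 : ℤ) ^ (N - k) * N.choose k) • P.eval (0 + k • (1 : ℝ)) := by
    rw [Finset.mul_sum]
    refine Finset.sum_congr rfl fun m hm => ?_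
    obtain ⟨d, rfl⟩ := Nat.exists_eq_add_of_le (Finset.mem_range_succ_iff.mp hm)
    have : ((-1 : ℝ) ^ d) * (-1) ^ d = 1 := by rw [← mul_pow]; simp
    simp only [zsmul_eq_mul, nsmul_eq_mul, mul_one, zero_add, add_tsub_cancel_left]
    push_cast
    rw [pow_add]
    linear_combination (-(-1 : ℝ) ^ m * ((m + d).choose m) * P.eval (m : ℝ)) * this
  rw [h2, h]
  simp

open Polynomial Nat in
theorem sum_alternating_choose_mul_factorial_div (N b k : ℕ) (hk : k ≤ N) :
    ∑ m ∈ Finset.range (N + 1), (-1 : ℝ) ^ m * N.choose m *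
      ((N + b + m)! / (b + m + k + 1)! : ℝ) =
      if k = N then (N ! * (N + b)! : ℝ) / (2 * N + b + 1)! else 0 := by
  split_ifs with h
  · subst h
    have hB := integral_pow_mul_one_sub_pow (k + b) k
    have hx (x : ℝ) : x ^ (k + b) * (1 - x) ^ k =
        ∑ m ∈ Finset.range (k + 1), ((-1 : ℝ) ^ m * k.choose m) * x ^ (k + b + m) := by
      rw [show 1 - x = -x + 1 by ring, add_pow, Finset.mul_sum]
      refine Finset.sum_congr rfl fun m _ => ?_
      rw [neg_pow x]
      ring
    simp_rw [hx] at hB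
    rw [intervalIntegral.integral_finsetSum
      fun m _ => (by fun_prop : Continuous _).intervalIntegrable _ _] at hB
    simp_rw [intervalIntegral.integral_const_mul, integral_pow] at hB
    rw [show 2 * k + b + 1 = k + b + k + 1 by ring, mul_comm (k ! : ℝ), ← hB]
    refine Finset.sum_congr rfl fun m _ => ?_
    rw [show b + m + k + 1 = (k + b + m) + 1 by ring, Nat.factorial_succ]
    have : ((k + b + m)! : ℝ) ≠ 0 := by positivity
    push_cast
    field_simp
    simp
  · obtain ⟨d, rfl⟩ : ∃ d, N = k + 1 + d := Nat.exists_eq_add_of_le (by omega)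
    rw [← sum_alternating_choose_mul_eval_eq_zero (N := k + 1 + d)
      (P := (ascPochhammer ℝ d).comp (X + C ((b + k + 2 : ℕ) : ℝ)))]
    · refine Finset.sum_congr rfl fun m _ => ?_
      congr 1
      rw [eval_comp, eval_add, eval_X, eval_C, ← Nat.cast_add, ← ascPochhammer_eval_cast,
        ascPochhammer_nat_eq_ascFactorial, div_eq_iff (by positivity),
        show m + (b + k + 2) = (b + m + k + 1) + 1 by ring, mul_comm]
      rw [← Nat.cast_mul, Nat.factorial_mul_ascFactorial]
      congr 2
      ring
    · rw [natDegree_comp, natDegree_X_add_C, ascPochhammer_natDegree]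
      omega

open Nat in
/-- Coefficients of `P_N^{a,a}(t)` in powers of `(t - 1) / 2`. -/
noncomputable def jacobiCoeff (N a m : ℕ) : ℝ :=
  (N + a)! / (N ! * (N + 2 * a)!) * (N.choose m * ((N + 2 * a + m)! / (a + m)!))

open Polynomial in
/-- The polynomial `v ↦ P_N^{a,a}(2 v - 1)`. -/
noncomputable def shiftedJacobi (N a : ℕ) : ℝ[X] :=
  ∑ m ∈ Finset.range (N + 1), C (jacobiCoeff N a m) * (X - C 1) ^ m

open Polynomial in
theorem jacobiP_eq_eval_shiftedJacobi (N a : ℕ) (t : ℝ) :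
    jacobiP N a a t = (shiftedJacobi N a).eval ((1 + t) / 2) := by
  have e1 : (a : ℝ) + N + 1 = ((N + a : ℕ) : ℝ) + 1 := by push_cast; ring
  have e2 : (a : ℝ) + a + N + 1 = ((N + 2 * a : ℕ) : ℝ) + 1 := by push_cast; ring
  rw [jacobiP, shiftedJacobi, eval_finsetSum, Finset.mul_sum]
  refine Finset.sum_congr rfl fun m _ => ?_
  have e3 : (a : ℝ) + a + N + m + 1 = ((N + 2 * a + m : ℕ) : ℝ) + 1 := by push_cast; ring
  have e4 : (a : ℝ) + m + 1 = ((a + m : ℕ) : ℝ) + 1 := by push_cast; ring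
  rw [e1, e2, e3, e4]
  simp only [Real.Gamma_nat_eq_factorial, jacobiCoeff, eval_mul, eval_C, eval_pow, eval_sub, eval_X]
  rw [show (t - 1) / 2 = (1 + t) / 2 - 1 by ring]
  ring

open Polynomial in
theorem natDegree_shiftedJacobi_le (N a : ℕ) : (shiftedJacobi N a).natDegree ≤ N := by
  refine natDegree_sum_le_of_forall_le _ _ fun m hm => ?_
  refine (natDegree_C_mul_le _ _).trans ?_
  rw [natDegree_pow, natDegree_X_sub_C, mul_one]
  exact Finset.mem_range_succ_iff.mp hm

open Polynomial Nat in
theorem coeff_shiftedJacobi_self (N a : ℕ) :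
    (shiftedJacobi N a).coeff N = (2 * N + 2 * a)! / (N ! * (N + 2 * a)!) := by
  have hd (m : ℕ) : ((X - C (1 : ℝ)) ^ m).natDegree = m := by
    rw [natDegree_pow, natDegree_X_sub_C, mul_one]
  rw [shiftedJacobi, finsetSum_coeff, Finset.sum_range_succ, Finset.sum_eq_zero, zero_add,
    coeff_C_mul]
  · have h1 : ((X - C (1 : ℝ)) ^ N).coeff N = 1 := by
      have := ((monic_X_sub_C (1 : ℝ)).pow N).coeff_natDegree
      rwa [hd] at this
    rw [h1, jacobiCoeff, Nat.choose_self, show N + 2 * a + N = 2 * N + 2 * a by ring, add_comm a N]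
    have : ((N + a)! : ℝ) ≠ 0 := by positivity
    field_simp
    simp
  · intro m hm
    rw [coeff_C_mul, coeff_eq_zero_of_natDegree_lt, mul_zero]
    rw [hd]
    exact Finset.mem_range.mp hm

open Polynomial Nat in
theorem integral_pow_mul_shiftedJacobi (N a k : ℕ) (hk : k ≤ N) :
    ∫ v in (0 : ℝ)..1, v ^ k * (shiftedJacobi N a).eval v * (v * (1 - v)) ^ a =
      if k = N then ((N + a)! : ℝ) ^ 2 / (2 * N + 2 * a + 1)! else 0 := by
  have hx (v : ℝ) : v ^ k * (shiftedJacobi N a).eval v * (v * (1 - v)) ^ a =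
      ∑ m ∈ Finset.range (N + 1),
        (jacobiCoeff N a m * (-1) ^ m) * (v ^ (a + k) * (1 - v) ^ (a + m)) := by
    rw [shiftedJacobi, eval_finsetSum, Finset.mul_sum, Finset.sum_mul]
    refine Finset.sum_congr rfl fun m _ => ?_
    simp only [eval_mul, eval_C, eval_pow, eval_sub, eval_X]
    rw [show v - 1 = -1 * (1 - v) by ring, mul_pow, mul_pow]
    ring
  simp_rw [hx]
  rw [intervalIntegral.integral_finsetSum
      fun m _ => (by fun_prop : Continuous _).intervalIntegrable _ _]
  simp_rw [intervalIntegral.integral_const_mul, integral_pow_mul_one_sub_pow]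
  have hS := sum_alternating_choose_mul_factorial_div N (2 * a) k hk
  have hsum : ∑ m ∈ Finset.range (N + 1), jacobiCoeff N a m * (-1) ^ m *
        (((a + k)! * (a + m)! : ℝ) / (a + k + (a + m) + 1)!) =
      ((a + k)! * (N + a)! / (N ! * (N + 2 * a)!) : ℝ) *
        ∑ m ∈ Finset.range (N + 1), (-1 : ℝ) ^ m * N.choose m *
          ((N + 2 * a + m)! / (2 * a + m + k + 1)! : ℝ) := by
    rw [Finset.mul_sum]
    refine Finset.sum_congr rfl fun m _ => ?_
    rw [jacobiCoeff, show a + k + (a + m) + 1 = 2 * a + m + k + 1 by ring]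
    have : ((a + m)! : ℝ) ≠ 0 := by positivity
    field_simp
  rw [hsum, hS]
  split_ifs with h
  · subst h
    have h1 : (k ! : ℝ) ≠ 0 := by positivity
    have h2 : ((k + 2 * a)! : ℝ) ≠ 0 := by positivity
    rw [add_comm a k]
    field_simp
  · rw [mul_zero]

open Polynomial Nat in
theorem integral_mul_shiftedJacobi (N a : ℕ) (r : ℝ[X]) (hr : r.natDegree ≤ N) :
    ∫ v in (0 : ℝ)..1, r.eval v * (shiftedJacobi N a).eval v * (v * (1 - v)) ^ a =
      r.coeff N * (((N + a)! : ℝ) ^ 2 / (2 * N + 2 * a + 1)!) := by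
  have hx (v : ℝ) : r.eval v * (shiftedJacobi N a).eval v * (v * (1 - v)) ^ a =
      ∑ k ∈ Finset.range (N + 1),
        r.coeff k * (v ^ k * (shiftedJacobi N a).eval v * (v * (1 - v)) ^ a) := by
    rw [eval_eq_sum_range' (Nat.lt_succ_of_le hr), Finset.sum_mul, Finset.sum_mul]
    refine Finset.sum_congr rfl fun m _ => ?_
    ring
  simp_rw [hx]
  rw [intervalIntegral.integral_finsetSum
      fun m _ => (by fun_prop : Continuous _).intervalIntegrable _ _]
  simp_rw [intervalIntegral.integral_const_mul]
  rw [Finset.sum_range_succ, Finset.sum_eq_zero, zero_add,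
    integral_pow_mul_shiftedJacobi N a N le_rfl, if_pos rfl]
  intro k hk
  have hk' := Finset.mem_range.mp hk
  rw [integral_pow_mul_shiftedJacobi N a k hk'.le, if_neg hk'.ne, mul_zero]

open Polynomial Nat in
theorem integral_shiftedJacobi_mul_shiftedJacobi (N N' a : ℕ) :
    ∫ v in (0 : ℝ)..1,
        (shiftedJacobi N a).eval v * (shiftedJacobi N' a).eval v * (v * (1 - v)) ^ a =
      if N = N' then ((N + a)! : ℝ) ^ 2 / ((2 * N + 2 * a + 1) * (N ! * (N + 2 * a)!))
      else 0 := by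
  rcases lt_trichotomy N N' with h | rfl | h
  · have hd := natDegree_shiftedJacobi_le N a
    rw [integral_mul_shiftedJacobi _ _ _ (hd.trans h.le),
      coeff_eq_zero_of_natDegree_lt (hd.trans_lt h), if_neg h.ne, zero_mul]
  · rw [integral_mul_shiftedJacobi _ _ _ (natDegree_shiftedJacobi_le N a),
      coeff_shiftedJacobi_self, if_pos rfl, Nat.factorial_succ]
    have : ((2 * N + 2 * a)! : ℝ) ≠ 0 := by positivity
    push_cast
    field_simp
  · have hd := natDegree_shiftedJacobi_le N' a
    simp_rw [mul_comm (eval _ (shiftedJacobi N a))]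
    rw [integral_mul_shiftedJacobi _ _ _ (hd.trans h.le),
      coeff_eq_zero_of_natDegree_lt (hd.trans_lt h), if_neg h.ne', zero_mul]

open Nat in
/-- Orthogonality of the Jacobi polynomials `P_N^{a,a}`, in the variable `t = cos θ`. -/
theorem integral_sin_pow_mul_jacobiP_mul_jacobiP (N N' a : ℕ) :
    ∫ θ in (0 : ℝ)..π,
        sin θ ^ (2 * a + 1) * (jacobiP N a a (cos θ) * jacobiP N' a a (cos θ)) =
      if N = N' then
        2 * 4 ^ a * (((N + a)! : ℝ) ^ 2 / ((2 * N + 2 * a + 1) * (N ! * (N + 2 * a)!)))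
      else 0 := by
  have hsub := intervalIntegral.integral_comp_mul_deriv (a := 0) (b := π)
    (f := fun θ => (1 + cos θ) / 2) (f' := fun θ => -sin θ / 2)
    (g := fun v => (shiftedJacobi N a).eval v * (shiftedJacobi N' a).eval v * (v * (1 - v)) ^ a)
    (fun θ _ => ((hasDerivAt_cos θ).const_add 1).div_const 2)
    (by fun_prop) (by fun_prop)
  have hx (θ : ℝ) :
      sin θ ^ (2 * a + 1) * (jacobiP N a a (cos θ) * jacobiP N' a a (cos θ)) =
        (-2 * 4 ^ a) * (((fun v => (shiftedJacobi N a).eval v * (shiftedJacobi N' a).eval v *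
          (v * (1 - v)) ^ a) ∘ fun θ => (1 + cos θ) / 2) θ * (-sin θ / 2)) := by
    have h4 : (1 + cos θ) / 2 * (1 - (1 + cos θ) / 2) = sin θ ^ 2 / 4 := by
      rw [sin_sq]; ring
    simp only [Function.comp_apply, jacobiP_eq_eval_shiftedJacobi, h4]
    rw [div_pow, pow_succ, pow_mul]
    field_simp
  simp_rw [hx]
  rw [intervalIntegral.integral_const_mul, hsub]
  simp only [cos_zero, cos_pi]
  rw [show ((1 : ℝ) + 1) / 2 = 1 by norm_num, show ((1 : ℝ) + -1) / 2 = 0 by norm_num,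
    intervalIntegral.integral_symm, integral_shiftedJacobi_mul_shiftedJacobi]
  split_ifs <;> ring

theorem integral_cos_int_mul (k : ℤ) :
    ∫ φ in (0 : ℝ)..(2 * π), cos (k * φ) = if k = 0 then 2 * π else 0 := by
  split_ifs with h
  · simp [h]
  · have hk : (k : ℝ) ≠ 0 := by exact_mod_cast h
    have h2 := sin_int_mul_two_pi_sub 0 k
    rw [intervalIntegral.integral_comp_mul_left (fun x => cos x) hk, integral_cos]
    rw [sub_zero, sin_zero, neg_zero] at h2
    simp [h2]

theorem integral_sin_int_mul (k : ℤ) : ∫ φ in (0 : ℝ)..(2 * π), sin (k * φ) = 0 := by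
  by_cases h : k = 0
  · simp [h]
  · have hk : (k : ℝ) ≠ 0 := by exact_mod_cast h
    rw [intervalIntegral.integral_comp_mul_left (fun x => sin x) hk, integral_sin]
    simp [cos_int_mul_two_pi]

/-- The azimuthal factor of `Y_l^n`. -/
noncomputable def sphAzimuth (l : ℕ) (φ : ℝ) : ℝ :=
  if l = 1 ∨ l % 2 = 0 then cos ((l / 2 : ℕ) * φ) else sin ((l / 2 : ℕ) * φ)

theorem integral_cos_mul_cos (i j : ℕ) :
    ∫ φ in (0 : ℝ)..(2 * π), cos (i * φ) * cos (j * φ) =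
      ((if (i : ℤ) - j = 0 then 2 * π else 0) + if (i : ℤ) + j = 0 then 2 * π else 0) / 2 := by
  have hx (φ : ℝ) : cos (i * φ) * cos (j * φ) =
      (cos (((i : ℤ) - j : ℤ) * φ) + cos (((i : ℤ) + j : ℤ) * φ)) / 2 := by
    push_cast
    rw [sub_mul, add_mul, cos_sub, cos_add]
    ring
  simp_rw [hx]
  rw [intervalIntegral.integral_div, intervalIntegral.integral_add
    ((by fun_prop : Continuous _).intervalIntegrable _ _)
    ((by fun_prop : Continuous _).intervalIntegrable _ _),
    integral_cos_int_mul, integral_cos_int_mul]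

theorem integral_sin_mul_sin (i j : ℕ) :
    ∫ φ in (0 : ℝ)..(2 * π), sin (i * φ) * sin (j * φ) =
      ((if (i : ℤ) - j = 0 then 2 * π else 0) - if (i : ℤ) + j = 0 then 2 * π else 0) / 2 := by
  have hx (φ : ℝ) : sin (i * φ) * sin (j * φ) =
      (cos (((i : ℤ) - j : ℤ) * φ) - cos (((i : ℤ) + j : ℤ) * φ)) / 2 := by
    push_cast
    rw [sub_mul, add_mul, cos_sub, cos_add]
    ring
  simp_rw [hx]
  rw [intervalIntegral.integral_div, intervalIntegral.integral_sub
    ((by fun_prop : Continuous _).intervalIntegrable _ _)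
    ((by fun_prop : Continuous _).intervalIntegrable _ _),
    integral_cos_int_mul, integral_cos_int_mul]

theorem integral_sin_mul_cos (i j : ℕ) :
    ∫ φ in (0 : ℝ)..(2 * π), sin (i * φ) * cos (j * φ) = 0 := by
  have hx (φ : ℝ) : sin (i * φ) * cos (j * φ) =
      (sin (((i : ℤ) - j : ℤ) * φ) + sin (((i : ℤ) + j : ℤ) * φ)) / 2 := by
    push_cast
    rw [sub_mul, add_mul, sin_sub, sin_add]
    ring
  simp_rw [hx]
  rw [intervalIntegral.integral_div, intervalIntegral.integral_add
    ((by fun_prop : Continuous _).intervalIntegrable _ _)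
    ((by fun_prop : Continuous _).intervalIntegrable _ _),
    integral_sin_int_mul, integral_sin_int_mul]
  simp

theorem integral_sphAzimuth_mul_sphAzimuth {l l' : ℕ} (hl : 1 ≤ l) (hl' : 1 ≤ l') :
    ∫ φ in (0 : ℝ)..(2 * π), sphAzimuth l φ * sphAzimuth l' φ =
      if l = l' then (if l = 1 then 2 * π else π) else 0 := by
  by_cases h : l = 1 ∨ l % 2 = 0 <;> by_cases h' : l' = 1 ∨ l' % 2 = 0 <;>
    simp only [sphAzimuth, h, h', if_true, if_false]
  · rw [integral_cos_mul_cos]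
    split_ifs <;> first | omega | ring
  · simp_rw [mul_comm (cos _)]
    rw [integral_sin_mul_cos, if_neg (by rintro rfl; exact h' h)]
  · rw [integral_sin_mul_cos, if_neg (by rintro rfl; exact h h')]
  · rw [integral_sin_mul_sin]
    split_ifs <;> first | omega | ring

/-- The normalization constant of `Y_l^n`, including the extra factor in the zonal case. -/
noncomputable def sphNorm (n l : ℕ) : ℝ :=
  if l = 1 then √((2 * n + 1) / (4 * π)) else sphC n (l / 2)

theorem sphY_eq_mul_sphAzimuth (n l : ℕ) (θ φ : ℝ) :
    sphY n l θ φ = sphNorm n l * sin θ ^ (l / 2) *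
      jacobiP (n - l / 2) (l / 2 : ℕ) (l / 2 : ℕ) (cos θ) * sphAzimuth l φ := by
  rw [sphY, sphNorm, sphAzimuth]
  by_cases h1 : l = 1
  · subst h1
    simp
  · by_cases h2 : l % 2 = 0
    · simp only [h1, h2, if_true, if_false, or_true]
      ring
    · simp only [h1, h2, if_false, or_self]
      ring

open Nat in
theorem sphNorm_sq_mul {n l : ℕ} (hl : 1 ≤ l) (hln : l ≤ 2 * n + 1) :
    sphNorm n l ^ 2 * (if l = 1 then 2 * π else π) * (2 * 4 ^ (l / 2) *
      ((n ! : ℝ) ^ 2 / ((2 * n + 1) * ((n - l / 2)! * (n + l / 2)!)))) = 1 := by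
  have hn : (n ! : ℝ) ≠ 0 := by positivity
  rw [sphNorm]
  by_cases h1 : l = 1
  · subst h1
    simp only [if_true]
    rw [sq_sqrt (by positivity)]
    simp
    field_simp
    norm_num
  · simp only [h1, if_false]
    have hj : l / 2 ≤ n := by omega
    generalize l / 2 = j at hj
    rw [sphC, ← Nat.cast_sub hj, ← Nat.cast_add]
    simp only [Real.Gamma_nat_eq_factorial]
    rw [mul_pow, sq_sqrt (by positivity), show (4 : ℝ) = 2 ^ 2 by norm_num, ← pow_mul]
    have h3 : ((n - j)! : ℝ) ≠ 0 := by positivity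
    have h4 : ((n + j)! : ℝ) ≠ 0 := by positivity
    field_simp
    ring

/-- orthonormality of the spherical harmonics on the unit sphere. -/
theorem spherical_harmonics_orthonormal (n n' l l' : ℕ)
    (hl1 : 1 ≤ l) (hl2 : l ≤ 2 * n + 1) (hl1' : 1 ≤ l') (hl2' : l' ≤ 2 * n' + 1) :
    (∫ θ in (0 : ℝ)..Real.pi, ∫ φ in (0 : ℝ)..(2 * Real.pi),
        sphY n l θ φ * sphY n' l' θ φ * Real.sin θ) =
      if n = n' ∧ l = l' then 1 else 0 := by
  have hx (θ : ℝ) : ∫ φ in (0 : ℝ)..(2 * π), sphY n l θ φ * sphY n' l' θ φ * sin θ =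
      sphNorm n l * sphNorm n' l' * (if l = l' then (if l = 1 then 2 * π else π) else 0) *
        (sin θ ^ (l / 2 + l' / 2 + 1) * (jacobiP (n - l / 2) (l / 2 : ℕ) (l / 2 : ℕ) (cos θ) *
          jacobiP (n' - l' / 2) (l' / 2 : ℕ) (l' / 2 : ℕ) (cos θ))) := by
    rw [← integral_sphAzimuth_mul_sphAzimuth hl1 hl1', ← intervalIntegral.integral_const_mul,
      ← intervalIntegral.integral_mul_const]
    refine intervalIntegral.integral_congr fun φ _ => ?_
    simp only [sphY_eq_mul_sphAzimuth]
    ring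
  simp_rw [hx]
  rw [intervalIntegral.integral_const_mul]
  by_cases hll : l = l'
  · subst hll
    have hj : l / 2 ≤ n := by omega
    have hj' : l / 2 ≤ n' := by omega
    rw [← two_mul, integral_sin_pow_mul_jacobiP_mul_jacobiP, if_pos (rfl : l = l)]
    by_cases hn : n = n'
    · subst hn
      rw [if_pos rfl, if_pos (And.intro rfl rfl), Nat.sub_add_cancel hj,
        show n - l / 2 + 2 * (l / 2) = n + l / 2 by omega, Nat.cast_sub hj, ← pow_two]
      convert sphNorm_sq_mul hl1 hl2 using 6
      ring
    · rw [if_neg (by omega : ¬(n - l / 2 = n' - l / 2)), mul_zero,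
        if_neg (mt And.left hn)]
  · simp [hll]
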